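/- Let (W,S) be a Coxeter system with length function ℓ, and let W' ≤ W be a reflection subgroup, i.e. a subgroup generated by a set of reflections of W. For u ∈ W, the following are equivalent: (i) u is the unique element of minimal length in its coset uW', i.e. ℓ(u) ≤ ℓ(x) for all x ∈ uW'; (ii) for every reflection t of W with t ∈ W', one has ℓ(u t) > ℓ(u). -/

import Mathlib

namespace CoxeterSystem

open List Classical

variable {B W : Type*} [Group W] {M : CoxeterMatrix B} (cs : CoxeterSystem M W)

/-- The involution of `W × ZMod 2` which conjugates the first coordinate by the simple reflection
`s i`, and flips the sign recorded in the second coordinate exactly at `s i`. -/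
noncomputable def signedConj (i : B) : Equiv.Perm (W × ZMod 2) :=
  Function.Involutive.toPerm
    (fun p ↦ (cs.simple i * p.1 * cs.simple i, p.2 + if p.1 = cs.simple i then 1 else 0)) (by
      rintro ⟨t, e⟩
      have h : cs.simple i * t * cs.simple i = cs.simple i ↔ t = cs.simple i := by
        rw [mul_eq_right, mul_eq_one_iff_inv_eq, inv_simple, eq_comm]
      have h2 : (1 : ZMod 2) + 1 = 0 := by decide
      ext
      · simp [mul_assoc]
      · by_cases ht : t = cs.simple i <;> simp [h, ht, add_assoc, h2])

theorem signedConj_apply (i : B) (t : W) (e : ZMod 2) :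
    cs.signedConj i (t, e) =
      (cs.simple i * t * cs.simple i, e + if t = cs.simple i then 1 else 0) := rfl

theorem simple_mul_pow_simple_mul_simple (i j : B) (n : ℕ) :
    cs.simple j * (cs.simple i * cs.simple j) ^ n =
      ((cs.simple i * cs.simple j) ^ n)⁻¹ * cs.simple j := by
  induction n with
  | zero => simp
  | succ n ih =>
    rw [pow_succ, ← mul_assoc, ih, ← pow_succ, pow_succ']
    simp [mul_assoc]

theorem signedConj_mul_signedConj_pow_apply (i j : B) (n : ℕ) (t : W) (e : ZMod 2) :
    ((cs.signedConj i * cs.signedConj j) ^ n) (t, e) =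
      ((cs.simple i * cs.simple j) ^ n * t * ((cs.simple i * cs.simple j) ^ n)⁻¹,
        e + ∑ k ∈ Finset.range (2 * n),
          if (cs.simple i * cs.simple j) ^ k * t = cs.simple j then 1 else 0) := by
  induction n with
  | zero => simp
  | succ n ih =>
    rw [pow_succ', Equiv.Perm.mul_apply, ih, Equiv.Perm.mul_apply, signedConj_apply,
      signedConj_apply]
    have hc := cs.simple_mul_pow_simple_mul_simple i j n
    set p := cs.simple i * cs.simple j with hp
    have h1 : p ^ n * t * (p ^ n)⁻¹ = cs.simple j ↔ p ^ (2 * n) * t = cs.simple j := by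
      rw [mul_inv_eq_iff_eq_mul, hc, eq_inv_mul_iff_mul_eq, two_mul, pow_add]
      simp only [mul_assoc]
    have h2 : cs.simple j * (p ^ n * t * (p ^ n)⁻¹) * cs.simple j = cs.simple i ↔
        p ^ (2 * n + 1) * t = cs.simple j := by
      rw [← mul_left_inj (cs.simple j), ← hp, simple_mul_simple_cancel_right, ← mul_assoc,
        ← mul_assoc, hc, mul_inv_eq_iff_eq_mul, ← pow_succ', mul_assoc, inv_mul_eq_iff_eq_mul,
        ← pow_add, ← mul_right_inj (cs.simple j), simple_mul_simple_cancel_left,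
        show n + (n + 1) = 2 * n + 1 by ring, simple_mul_pow_simple_mul_simple,
        eq_inv_mul_iff_mul_eq]
    ext
    · simp [hp, pow_succ', mul_assoc]
    · simp only [h1, h2]
      rw [show 2 * (n + 1) = 2 * n + 1 + 1 by ring, Finset.sum_range_succ, Finset.sum_range_succ]
      ring

theorem isLiftable_signedConj : M.IsLiftable cs.signedConj := by
  intro i j
  ext1 ⟨t, e⟩
  rw [signedConj_mul_signedConj_pow_apply, two_mul, Finset.sum_range_add]
  simp only [pow_add, simple_mul_simple_pow, one_mul, CharTwo.add_self_eq_zero]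
  simp

/-- The action of `W` on `W × ZMod 2` extending `signedConj`. -/
noncomputable def signedConjHom : W →* Equiv.Perm (W × ZMod 2) :=
  cs.lift ⟨cs.signedConj, cs.isLiftable_signedConj⟩

/-- The reflection cocycle: the multiplicity modulo 2 of `t` in the right inversion sequence of any
word for `w` (see `reflectionCocycle_wordProd`). -/
noncomputable def reflectionCocycle (w t : W) : ZMod 2 := (cs.signedConjHom w (t, 0)).2

theorem signedConjHom_wordProd_apply (ω : List B) (t : W) (e : ZMod 2) :
    cs.signedConjHom (cs.wordProd ω) (t, e) =
      (cs.wordProd ω * t * (cs.wordProd ω)⁻¹, e + ((cs.rightInvSeq ω).count t : ZMod 2)) := by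
  induction ω with
  | nil => simp
  | cons i ω ih =>
    rw [wordProd_cons, map_mul, Equiv.Perm.mul_apply, ih, signedConjHom, lift_apply_simple,
      signedConj_apply, rightInvSeq, List.count_cons]
    have h : cs.wordProd ω * t * (cs.wordProd ω)⁻¹ = cs.simple i ↔
        (cs.wordProd ω)⁻¹ * cs.simple i * cs.wordProd ω = t := by
      rw [mul_inv_eq_iff_eq_mul, ← eq_inv_mul_iff_mul_eq, eq_comm, mul_assoc]
    ext
    · simp [mul_assoc]
    · simp [h, add_assoc]

theorem reflectionCocycle_wordProd (ω : List B) (t : W) :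
    cs.reflectionCocycle (cs.wordProd ω) t = ((cs.rightInvSeq ω).count t : ZMod 2) := by
  simp [reflectionCocycle, signedConjHom_wordProd_apply]

theorem reflectionCocycle_mul (x y t : W) :
    cs.reflectionCocycle (x * y) t =
      cs.reflectionCocycle y t + cs.reflectionCocycle x (y * t * y⁻¹) := by
  obtain ⟨ω, rfl⟩ := cs.wordProd_surjective x
  obtain ⟨ω', rfl⟩ := cs.wordProd_surjective y
  simp only [reflectionCocycle, map_mul, Equiv.Perm.mul_apply, signedConjHom_wordProd_apply,
    zero_add]

@[simp] theorem reflectionCocycle_one (t : W) : cs.reflectionCocycle 1 t = 0 := by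
  simp [reflectionCocycle]

theorem reflectionCocycle_simple (i : B) (t : W) :
    cs.reflectionCocycle (cs.simple i) t = if t = cs.simple i then 1 else 0 := by
  simp [reflectionCocycle, signedConjHom, signedConj_apply]

theorem isRightInversion_of_reflectionCocycle_ne_zero {w t : W}
    (h : cs.reflectionCocycle w t ≠ 0) : cs.IsRightInversion w t := by
  obtain ⟨ω, hω, rfl⟩ := cs.exists_isReduced w
  refine cs.isRightInversion_of_mem_rightInvSeq hω ?_
  by_contra ht
  exact h (by rw [reflectionCocycle_wordProd, List.count_eq_zero_of_not_mem ht, Nat.cast_zero])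

/-- The canonical generators of a reflection subgroup: the elements of the subgroup
whose reflection cocycle, restricted to the subgroup, is supported at the element itself. -/
def canonicalGenerators (H : Subgroup W) : Set W :=
  {r | r ∈ H ∧ ∀ t ∈ H, cs.reflectionCocycle r t = if t = r then 1 else 0}

variable {cs}

theorem isReflection_of_mem_canonicalGenerators {H : Subgroup W} {r : W}
    (hr : r ∈ cs.canonicalGenerators H) : cs.IsReflection r :=
  (cs.isRightInversion_of_reflectionCocycle_ne_zero (w := r) (t := r) (by simp [hr.2 r hr.1])).1

theorem simple_mem_canonicalGenerators {H : Subgroup W} {i : B} (hi : cs.simple i ∈ H) :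
    cs.simple i ∈ cs.canonicalGenerators H :=
  ⟨hi, fun t _ ↦ cs.reflectionCocycle_simple i t⟩

theorem conj_mem_canonicalGenerators {H : Subgroup W} {i : B} (hi : cs.simple i ∉ H) {r : W}
    (hr : r ∈ cs.canonicalGenerators (H.comap (MulAut.conj (cs.simple i)).toMonoidHom)) :
    MulAut.conj (cs.simple i) r ∈ cs.canonicalGenerators H := by
  obtain ⟨hrH, hr⟩ := hr
  have hrH' : cs.simple i * r * cs.simple i ∈ H := by simpa using hrH
  refine ⟨hrH, fun t ht ↦ ?_⟩
  have h1 : t ≠ cs.simple i := fun h ↦ hi (h ▸ ht)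
  have h2 : r * (cs.simple i * t * cs.simple i) * r⁻¹ ≠ cs.simple i := by
    intro h
    apply hi
    have := H.mul_mem (H.mul_mem hrH' ht) (H.inv_mem hrH')
    convert this using 1
    rw [eq_comm, ← mul_right_inj (cs.simple i), ← mul_left_inj (cs.simple i)]
    simpa [mul_assoc] using h
  have h3 : cs.simple i * t * cs.simple i = r ↔ t = cs.simple i * r * cs.simple i := by
    rw [← mul_right_inj (cs.simple i), ← mul_left_inj (cs.simple i)]
    simp [mul_assoc]
  have := hr (cs.simple i * t * cs.simple i) (by simpa [mul_assoc] using ht)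
  simp only [MulAut.conj_apply, cs.inv_simple]
  rw [reflectionCocycle_mul, reflectionCocycle_mul, reflectionCocycle_simple, if_neg h1,
    cs.inv_simple, reflectionCocycle_simple, if_neg h2, this]
  simp [h3]

/-- Every reflection in a subgroup is a product of canonical generators of the subgroup. -/
theorem IsReflection.mem_closure_canonicalGenerators {H : Subgroup W} {t : W}
    (ht : cs.IsReflection t) (htH : t ∈ H) :
    t ∈ Subgroup.closure (cs.canonicalGenerators H) := by
  obtain ⟨w, i, rfl⟩ := ht
  obtain ⟨ω, rfl⟩ := cs.wordProd_surjective w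
  induction ω generalizing H with
  | nil =>
    simp only [wordProd_nil, one_mul, inv_one, mul_one] at htH ⊢
    exact Subgroup.subset_closure (simple_mem_canonicalGenerators htH)
  | cons j ω ih =>
    set t' := cs.wordProd ω * cs.simple i * (cs.wordProd ω)⁻¹ with ht'
    have e : cs.wordProd (j :: ω) * cs.simple i * (cs.wordProd (j :: ω))⁻¹ =
        cs.simple j * t' * cs.simple j := by
      simp [ht', wordProd_cons, mul_assoc]
    rw [e] at htH ⊢
    by_cases hj : cs.simple j ∈ H
    · have hs := Subgroup.subset_closure (simple_mem_canonicalGenerators hj)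
      refine mul_mem (mul_mem hs (ih ?_)) hs
      simpa [mul_assoc] using H.mul_mem (H.mul_mem hj htH) hj
    · have h := ih (H := H.comap (MulAut.conj (cs.simple j)).toMonoidHom) (by simpa using htH)
      have hle : Subgroup.closure
          (cs.canonicalGenerators (H.comap (MulAut.conj (cs.simple j)).toMonoidHom)) ≤
          (Subgroup.closure (cs.canonicalGenerators H)).comap
            (MulAut.conj (cs.simple j)).toMonoidHom :=
        (Subgroup.closure_le _).2 fun r hr ↦
          Subgroup.subset_closure (conj_mem_canonicalGenerators hj hr)
      simpa using hle h

/-- The exchange property for products of canonical generators. -/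
theorem exists_prod_eq_of_reflectionCocycle_ne_zero {H : Subgroup W} {l : List W}
    (hl : ∀ r ∈ l, r ∈ cs.canonicalGenerators H) {t : W} (ht : t ∈ H)
    (h : cs.reflectionCocycle l.prod t ≠ 0) :
    ∃ l' : List W, (∀ r ∈ l', r ∈ cs.canonicalGenerators H) ∧ l'.prod = l.prod * t ∧
      l'.length + 1 = l.length := by
  induction l with
  | nil => simp at h
  | cons r l ih =>
    rw [List.forall_mem_cons] at hl
    by_cases h0 : cs.reflectionCocycle l.prod t = 0
    · have hlH : l.prod ∈ H := H.list_prod_mem fun x hx ↦ (hl.2 x hx).1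
      rw [List.prod_cons, reflectionCocycle_mul, h0, zero_add,
        hl.1.2 _ (H.mul_mem (H.mul_mem hlH ht) (H.inv_mem hlH))] at h
      have hr : l.prod * t * l.prod⁻¹ = r := by by_contra hne; simp [hne] at h
      refine ⟨l, hl.2, ?_, rfl⟩
      rw [mul_inv_eq_iff_eq_mul] at hr
      rw [List.prod_cons, mul_assoc, hr, ← mul_assoc,
        (isReflection_of_mem_canonicalGenerators hl.1).mul_self, one_mul]
    · obtain ⟨l', hl', hp, hlen⟩ := ih hl.2 h0
      exact ⟨r :: l', List.forall_mem_cons.2 ⟨hl.1, hl'⟩, by simp [hp, mul_assoc],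
        by simp [hlen]⟩

theorem prod_eq_one_of_reflectionCocycle_eq_zero {H : Subgroup W} (l : List W)
    (hl : ∀ r ∈ l, r ∈ cs.canonicalGenerators H)
    (h : ∀ t ∈ H, cs.reflectionCocycle l.prod t = 0) : l.prod = 1 := by
  match l with
  | [] => rfl
  | r :: l =>
    rw [List.forall_mem_cons] at hl
    have hlH : l.prod ∈ H := H.list_prod_mem fun x hx ↦ (hl.2 x hx).1
    have htH : l.prod⁻¹ * r * l.prod ∈ H := H.mul_mem (H.mul_mem (H.inv_mem hlH) hl.1.1) hlH
    have h1 : cs.reflectionCocycle l.prod (l.prod⁻¹ * r * l.prod) ≠ 0 := by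
      intro h0
      have := h _ htH
      rw [List.prod_cons, reflectionCocycle_mul, h0,
        show l.prod * (l.prod⁻¹ * r * l.prod) * l.prod⁻¹ = r by group, hl.1.2 r hl.1.1] at this
      simp at this
    obtain ⟨l', hl', hp, hlen⟩ := exists_prod_eq_of_reflectionCocycle_ne_zero hl.2 htH h1
    have e : (r :: l).prod = l'.prod := by rw [hp, List.prod_cons]; group
    rw [e] at h ⊢
    exact prod_eq_one_of_reflectionCocycle_eq_zero l' hl' h
termination_by l.length
decreasing_by simp; omega

/-- An element of a reflection subgroup whose reflection cocycle vanishes on the subgroup is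
trivial. -/
theorem eq_one_of_reflectionCocycle_eq_zero {T : Set W} (hT : ∀ t ∈ T, cs.IsReflection t) {w : W}
    (hw : w ∈ Subgroup.closure T)
    (h : ∀ t ∈ Subgroup.closure T, cs.reflectionCocycle w t = 0) : w = 1 := by
  have hle : Subgroup.closure T ≤
      Subgroup.closure (cs.canonicalGenerators (Subgroup.closure T)) :=
    (Subgroup.closure_le _).2 fun t ht ↦
      (hT t ht).mem_closure_canonicalGenerators (Subgroup.subset_closure ht)
  have hw' := hle hw
  rw [← Subgroup.mem_toSubmonoid, Subgroup.closure_toSubmonoid] at hw'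
  obtain ⟨l, hl, rfl⟩ := Submonoid.exists_list_of_mem_closure hw'
  refine prod_eq_one_of_reflectionCocycle_eq_zero l (fun r hr ↦ (hl r hr).elim id fun h ↦ ?_) h
  rw [← inv_inv r, (isReflection_of_mem_canonicalGenerators h).inv]
  exact h

/-- Right multiplication by a reflection strictly lengthens an element of minimal length in its
coset. -/
theorem IsReflection.length_lt_length_mul_of_minimal {H : Subgroup W} {u t : W}
    (hu : ∀ x : W, u⁻¹ * x ∈ H → cs.length u ≤ cs.length x)
    (ht : cs.IsReflection t) (htH : t ∈ H) : cs.length u < cs.length (u * t) :=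
  lt_of_le_of_ne (hu _ (by simpa using htH)) (ht.length_mul_left_ne u).symm

theorem reflectionCocycle_eq_zero_of_forall_lt {H : Subgroup W} {u : W}
    (hu : ∀ t : W, cs.IsReflection t → t ∈ H → cs.length u < cs.length (u * t))
    {t : W} (ht : t ∈ H) : cs.reflectionCocycle u t = 0 := by
  by_contra h
  obtain ⟨hr, hlt⟩ := cs.isRightInversion_of_reflectionCocycle_ne_zero h
  exact hlt.not_gt (hu t hr ht)

end CoxeterSystem


/-- An element `u` of a Coxeter group is the (unique) minimal-length element of
its left coset `u W'` with respect to a reflection subgroup `W'` if and only if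
right multiplication by any reflection lying in `W'` increases the length of `u`. -/
theorem minimal_coset_rep_iff_reflections_increase_length
    {B W : Type*} [Group W] {M : CoxeterMatrix B} (cs : CoxeterSystem M W)
    (W' : Subgroup W)
    (hrefl : ∃ T : Set W, (∀ t ∈ T, cs.IsReflection t) ∧ W' = Subgroup.closure T)
    (u : W) :
    (∀ x : W, u⁻¹ * x ∈ W' → cs.length u ≤ cs.length x) ↔
      (∀ t : W, cs.IsReflection t → t ∈ W' → cs.length u < cs.length (u * t)) := by
  refine ⟨fun hu t ht htW ↦ ht.length_lt_length_mul_of_minimal hu htW, fun hu x hx ↦ ?_⟩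
  obtain ⟨T, hT, rfl⟩ := hrefl
  obtain ⟨w, hw, hmin⟩ := exists_minimalFor_of_wellFoundedLT
    (fun w ↦ w ∈ Subgroup.closure T) (fun w ↦ cs.length (u * w)) ⟨1, one_mem _⟩
  have hle : ∀ y ∈ Subgroup.closure T, cs.length (u * w) ≤ cs.length (u * y) := fun y hy ↦
    (le_total _ _).elim id (hmin hy)
  have hv : ∀ t ∈ Subgroup.closure T, cs.reflectionCocycle (u * w) t = 0 := fun t ht ↦
    CoxeterSystem.reflectionCocycle_eq_zero_of_forall_lt (fun _ hr hrT ↦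
      hr.length_lt_length_mul_of_minimal (fun y hy ↦ by
        simpa using hle (u⁻¹ * y) (by simpa [mul_assoc] using mul_mem hw hy)) hrT) ht
  have hw1 : w = 1 := CoxeterSystem.eq_one_of_reflectionCocycle_eq_zero hT hw fun t ht ↦ by
    have h := hv t ht
    rwa [CoxeterSystem.reflectionCocycle_mul,
      CoxeterSystem.reflectionCocycle_eq_zero_of_forall_lt hu
        (mul_mem (mul_mem hw ht) (inv_mem hw)), add_zero] at h
  simpa [hw1] using hle _ hx
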